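/- arXiv:1801.06908 — 2 statements merged into one kernel-verified Lean document; each statement's English description precedes it below -/
import Mathlib

section
/- For all real numbers a ≥ 0, b ≥ 0 and c > 0 one has 0 ≤ 1/(a+b+c) − 1/(a+c) − 1/(b+c) + 1/c ≤ √(ab)/(2c²). -/
theorem alternating_inv_sum_eq {a b c : ℝ} (ha : 0 ≤ a) (hb : 0 ≤ b) (hc : 0 < c) :
    1 / (a + b + c) - 1 / (a + c) - 1 / (b + c) + 1 / c =
      a * b * (a + b + 2 * c) / (c * ((a + c) * (b + c) * (a + b + c))) := by
  have h₁ : a + b + c ≠ 0 := by positivity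
  have h₂ : a + c ≠ 0 := by positivity
  have h₃ : b + c ≠ 0 := by positivity
  field_simp
  ring

theorem two_mul_sqrt_mul_le_add {a b : ℝ} (ha : 0 ≤ a) (hb : 0 ≤ b) :
    2 * √(a * b) ≤ a + b := by
  have h := two_mul_le_add_sq √a √b
  rw [Real.sq_sqrt ha, Real.sq_sqrt hb] at h
  rwa [Real.sqrt_mul ha, ← mul_assoc]

theorem two_mul_mul_sqrt_mul_le {a b c : ℝ} (ha : 0 ≤ a) (hb : 0 ≤ b) (hc : 0 ≤ c) :
    2 * c * √(a * b) * (a + b + 2 * c) ≤ (a + c) * (b + c) * (a + b + c) := by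
  have hs : √(a * b) ^ 2 = a * b := Real.sq_sqrt (mul_nonneg ha hb)
  have hab := two_mul_sqrt_mul_le_add ha hb
  have h₁ : 0 ≤ (√(a * b) - c) ^ 2 * (a + b + c) := by positivity
  have h₂ : 0 ≤ c ^ 2 * (a + b - 2 * √(a * b)) :=
    mul_nonneg (sq_nonneg c) (sub_nonneg.2 hab)
  have h₃ : 0 ≤ c * (a + b) ^ 2 := by positivity
  linear_combination h₁ + h₂ + h₃ + (a + b + c) * hs

/-- For all real `a ≥ 0`, `b ≥ 0` and `c > 0`,
`0 ≤ 1/(a+b+c) − 1/(a+c) − 1/(b+c) + 1/c ≤ √(ab)/(2c²)`. -/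
theorem elementary_inequality (a b c : ℝ) (ha : 0 ≤ a) (hb : 0 ≤ b) (hc : 0 < c) :
    0 ≤ 1 / (a + b + c) - 1 / (a + c) - 1 / (b + c) + 1 / c ∧
    1 / (a + b + c) - 1 / (a + c) - 1 / (b + c) + 1 / c ≤
      Real.sqrt (a * b) / (2 * c ^ 2) := by
  rw [alternating_inv_sum_eq ha hb hc]
  refine ⟨by positivity, ?_⟩
  rw [div_le_div_iff₀ (by positivity) (by positivity)]
  have hs : √(a * b) ^ 2 = a * b := Real.sq_sqrt (mul_nonneg ha hb)
  have h := mul_le_mul_of_nonneg_left (two_mul_mul_sqrt_mul_le ha hb hc.le)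
    (mul_nonneg (Real.sqrt_nonneg (a * b)) hc.le)
  linear_combination h - 2 * c ^ 2 * (a + b + 2 * c) * hs
end

section
/- Let σ ∈ {+1, −1} and let z₀ be a real number with z₀ < 2m + σε. For all k₁, k₂ ∈ ℝ^d define Ψ₂^{(σ)}(k₁,k₂;z₀) := 1/(ω(k₁)+ω(k₂)+σε−z₀) − 1/(ω(k₁)+m+σε−z₀) − 1/(ω(k₂)+m+σε−z₀) + 1/(2m+σε−z₀). Then for all k₁, k₂ ∈ ℝ^d: 0 ≤ Ψ₂^{(σ)}(k₁,k₂;z₀) ≤ √(ω(k₁)−m)·√(ω(k₂)−m)/(2(2m+σε−z₀)²). -/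
open MeasureTheory Filter

theorem second_difference_inv_eq {c x y : ℝ} (hc : 0 < c) (hx : 0 ≤ x) (hy : 0 ≤ y) :
    1 / (c + x + y) - 1 / (c + x) - 1 / (c + y) + 1 / c =
      x * y * (2 * c + x + y) / (c * (c + x) * (c + y) * (c + x + y)) := by
  have h₁ : c + x ≠ 0 := by positivity
  have h₂ : c + y ≠ 0 := by positivity
  have h₃ : c + x + y ≠ 0 := by positivity
  field_simp
  ring

theorem second_difference_inv_le {c a b : ℝ} (hc : 0 < c) (ha : 0 ≤ a) (hb : 0 ≤ b) :
    a ^ 2 * b ^ 2 * (2 * c + a ^ 2 + b ^ 2) /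
        (c * (c + a ^ 2) * (c + b ^ 2) * (c + a ^ 2 + b ^ 2)) ≤
      a * b / (2 * c ^ 2) := by
  have hs : 0 ≤ a * b := mul_nonneg ha hb
  obtain ⟨q, hq, hpq⟩ : ∃ q, 0 ≤ q ∧ a ^ 2 + b ^ 2 = 2 * (a * b) + q :=
    ⟨(a - b) ^ 2, sq_nonneg _, by ring⟩
  have key : 2 * c * (a * b) * (2 * c + (a ^ 2 + b ^ 2)) ≤
      (c ^ 2 + c * (a ^ 2 + b ^ 2) + (a * b) ^ 2) * (c + (a ^ 2 + b ^ 2)) := by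
    rw [hpq]
    generalize a * b = s at *
    have h₁ : 0 ≤ (c + s) * (c ^ 2 - c * s + 2 * s ^ 2) :=
      mul_nonneg (by positivity) (by nlinarith [sq_nonneg (c - s), sq_nonneg s, sq_nonneg c])
    have h₂ : 0 ≤ q * (2 * c ^ 2 + 2 * c * s + s ^ 2 + c * q) := by positivity
    linarith
  rw [div_le_div_iff₀ (by positivity) (by positivity)]
  have h := mul_le_mul_of_nonneg_left key (mul_nonneg hc.le hs)
  linarith

/-- For `σ ∈ {+1, −1}` and `z₀ < 2m + σε`, the function
`Ψ₂^{(σ)}(k₁,k₂;z₀) = 1/(ω k₁ + ω k₂ + σε − z₀) − 1/(ω k₁ + m + σε − z₀)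
 − 1/(ω k₂ + m + σε − z₀) + 1/(2m + σε − z₀)` satisfies
`0 ≤ Ψ₂^{(σ)}(k₁,k₂;z₀) ≤ √(ω k₁ − m) · √(ω k₂ − m) / (2(2m + σε − z₀)²)`
for all `k₁, k₂ ∈ ℝ^d`. -/
theorem spin_boson_Psi2_bounds
    {d : ℕ} (hd : 1 ≤ d) {ε : ℝ} (hε : 0 < ε)
    {ω : (Fin d → ℝ) → ℝ} (hω_cont : Continuous ω)
    (hω_unbdd : ∀ M : ℝ, ∃ k, M < ω k)
    {m : ℝ} (hm_glb : IsGLB (Set.range ω) m) (hm_nonneg : 0 ≤ m)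
    {σ : ℝ} (hσ : σ = 1 ∨ σ = -1)
    {z₀ : ℝ} (hz₀ : z₀ < 2 * m + σ * ε) (k₁ k₂ : Fin d → ℝ) :
    0 ≤ 1 / (ω k₁ + ω k₂ + σ * ε - z₀) - 1 / (ω k₁ + m + σ * ε - z₀)
        - 1 / (ω k₂ + m + σ * ε - z₀) + 1 / (2 * m + σ * ε - z₀) ∧
    1 / (ω k₁ + ω k₂ + σ * ε - z₀) - 1 / (ω k₁ + m + σ * ε - z₀)
        - 1 / (ω k₂ + m + σ * ε - z₀) + 1 / (2 * m + σ * ε - z₀) ≤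
      Real.sqrt (ω k₁ - m) * Real.sqrt (ω k₂ - m) / (2 * (2 * m + σ * ε - z₀) ^ 2) := by
  have hx : 0 ≤ ω k₁ - m := sub_nonneg.2 (hm_glb.1 ⟨k₁, rfl⟩)
  have hy : 0 ≤ ω k₂ - m := sub_nonneg.2 (hm_glb.1 ⟨k₂, rfl⟩)
  have hc : 0 < 2 * m + σ * ε - z₀ := sub_pos.2 hz₀
  have heq := second_difference_inv_eq hc hx hy
  have hle := second_difference_inv_le hc (Real.sqrt_nonneg (ω k₁ - m))
    (Real.sqrt_nonneg (ω k₂ - m))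
  rw [Real.sq_sqrt hx, Real.sq_sqrt hy, ← heq] at hle
  have hnonneg : 0 ≤ (ω k₁ - m) * (ω k₂ - m) *
      (2 * (2 * m + σ * ε - z₀) + (ω k₁ - m) + (ω k₂ - m)) /
      ((2 * m + σ * ε - z₀) * (2 * m + σ * ε - z₀ + (ω k₁ - m)) *
        (2 * m + σ * ε - z₀ + (ω k₂ - m)) *
        (2 * m + σ * ε - z₀ + (ω k₁ - m) + (ω k₂ - m))) := by
    have := hc.le
    positivity
  rw [← heq] at hnonneg
  have e₁ : 2 * m + σ * ε - z₀ + (ω k₁ - m) + (ω k₂ - m) = ω k₁ + ω k₂ + σ * ε - z₀ := by ring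
  have e₂ : 2 * m + σ * ε - z₀ + (ω k₁ - m) = ω k₁ + m + σ * ε - z₀ := by ring
  have e₃ : 2 * m + σ * ε - z₀ + (ω k₂ - m) = ω k₂ + m + σ * ε - z₀ := by ring
  rw [e₁, e₂, e₃] at hle hnonneg
  exact ⟨hnonneg, hle⟩
end
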